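/- Let a₀, a₁, b₀, b₁ > 0 be real numbers, let m, n ≥ 1 and L ≥ 2 be integers, and set M = 2m, N = 2n. Let A(z) be the 2×2 matrix with rows (b₀, a₀) and (a₁z, b₁), and let W(z) = z^{−(m+n)}·A(z)^L for z ≠ 0. Fix a real ρ > |b₀−b₁| and define the scalar weight 𝒲(ω) = (1/(2a₀a₁))·((b₀+b₁+ω)/2)^L·(4a₀a₁/(ω²−(b₀−b₁)²))^{m+n}. Assume 𝓡 : ℂ×ℂ → M₂(ℂ) is a left reproducing kernel of order n for W on the unit circle, and assume 𝒦 : ℂ×ℂ → ℂ is a scalar left reproducing kernel of order 2n for 𝒲 on the circle of radius ρ which is moreover unique (any scalar bivariate polynomial of degree ≤ 2n−1 in each variable satisfying the same reproducing property equals 𝒦). Then for all integers x₁, x₂ with 1 ≤ x₁, x₂ ≤ L−1 and all y₁, y₂ ∈ ℤ, writing χ = 1 if x₁ > x₂ and χ = 0 otherwise, the following identity of 2×2 matrices holds: −(χ/(2πi))·∮_{|z|=1} A(z)^{x₁−x₂}·z^{y₂−y₁−1} dz + (1/(2πi))·∮_{|w|=1}∮_{|z|=1} w^{y₂−m−n}·z^{−y₁−1}·A(w)^{L−x₂}·𝓡(w,z)·A(z)^{x₁}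 dz dw = −(χ/(2πi·2a₀a₁))·∮_{|ζ|=ρ} ((b₀+b₁+ζ)/2)^{x₁−x₂}·((ζ²−(b₀−b₁)²)/(4a₀a₁))^{y₂−y₁−1}·M₁(ζ) dζ + (1/(2πi·4a₀²a₁²))·∮_{|ω|=ρ}∮_{|ζ|=ρ} 𝒦(ω,ζ)·((b₀+b₁+ζ)/2)^{x₁}·((b₀+b₁+ω)/2)^{L−x₂}·((ζ²−(b₁−b₀)²)/(4a₀a₁))^{−y₁−1}·((ω²−(b₁−b₀)²)/(4a₀a₁))^{y₂−m−n}·M₂(ζ,ω) dζ dω, where M₁(ζ) is the 2×2 matrix with rows ((ζ−b₁+b₀)/2, a₀) and ((ζ²−(b₁−b₀)²)/(4a₀), (ζ+b₁−b₀)/2), and M₂(ζ,ω) is the 2×2 matrix with rows ((ζ−(b₁−b₀))/2, a₀) and ((ζ−b₁+b₀)(ω+b₁−b₀)/(4a₀), (ω+b₁−b₀)/2). -/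

import Mathlib

/-- An `m × n` matrix polynomial of degree at most `d`:
`P z = ∑_{ℓ=0}^{d} z ^ ℓ • C ℓ` for some constant matrices `C ℓ`. -/
def IsMatPoly (m n d : ℕ) (P : ℂ → Matrix (Fin m) (Fin n) ℂ) : Prop :=
  ∃ C : ℕ → Matrix (Fin m) (Fin n) ℂ,
    ∀ z : ℂ, P z = ∑ ℓ ∈ Finset.range (d + 1), z ^ ℓ • C ℓ

/-- A scalar polynomial of degree at most `d`. -/
def IsPolyDeg (d : ℕ) (f : ℂ → ℂ) : Prop :=
  ∃ c : ℕ → ℂ, ∀ z : ℂ, f z = ∑ ℓ ∈ Finset.range (d + 1), c ℓ * z ^ ℓ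

/-- Entrywise counterclockwise integral of a matrix-valued function over the circle
`|z| = ρ` centered at the origin. -/
noncomputable def circleIntegralM {m n : ℕ} (ρ : ℝ) (F : ℂ → Matrix (Fin m) (Fin n) ℂ) :
    Matrix (Fin m) (Fin n) ℂ :=
  Matrix.of fun i j => circleIntegral (fun z => F z i j) 0 ρ

/-- `R` is a (matrix-valued) left reproducing kernel of order `N` for the weight `W` on
the circle `|z| = ρ`. -/
def IsLeftRKCircleM (r N : ℕ) (ρ : ℝ) (W : ℂ → Matrix (Fin r) (Fin r) ℂ)
    (R : ℂ → ℂ → Matrix (Fin r) (Fin r) ℂ) : Prop :=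
  (∀ z : ℂ, IsMatPoly r r (N - 1) fun w => R w z) ∧
  (∀ w : ℂ, IsMatPoly r r (N - 1) fun z => R w z) ∧
  ∀ P : ℂ → Matrix (Fin r) (Fin r) ℂ, IsMatPoly r r (N - 1) P →
    ∀ z : ℂ, circleIntegralM ρ (fun w => P w * W w * R w z) = P z

/-- `K` is a scalar left reproducing kernel of order `N` for the weight `W` on the circle
`|z| = ρ`. -/
def IsLeftRKCircleS (N : ℕ) (ρ : ℝ) (W : ℂ → ℂ) (K : ℂ → ℂ → ℂ) : Prop :=
  (∀ z : ℂ, IsPolyDeg (N - 1) fun w => K w z) ∧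
  (∀ w : ℂ, IsPolyDeg (N - 1) (K w)) ∧
  ∀ p : ℂ → ℂ, IsPolyDeg (N - 1) p →
    ∀ z : ℂ, circleIntegral (fun w => p w * W w * K w z) 0 ρ = p z

/-- The transition matrix of a lozenge tiling model with a `2 × 1` periodic weighting. -/
noncomputable def A16 (a0 a1 b0 b1 : ℝ) (z : ℂ) : Matrix (Fin 2) (Fin 2) ℂ :=
  !![(b0 : ℂ), (a0 : ℂ); (a1 : ℂ) * z, (b1 : ℂ)]

/-- The scalar weight `𝒲(ω) = (1/(2a₀a₁)) ((b₀+b₁+ω)/2)^L (4a₀a₁/(ω²-(b₀-b₁)²))^{(M+N)/2}`. -/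
noncomputable def scalW16 (a0 a1 b0 b1 : ℝ) (m n L : ℕ) (ω : ℂ) : ℂ :=
  (1 / (2 * (a0 : ℂ) * (a1 : ℂ))) * (((b0 : ℂ) + (b1 : ℂ) + ω) / 2) ^ L *
    ((4 * (a0 : ℂ) * (a1 : ℂ)) / (ω ^ 2 - ((b0 : ℂ) - (b1 : ℂ)) ^ 2)) ^ (m + n)

/-- The uniformizing coordinate `z = (ζ² - (b₀-b₁)²) / (4a₀a₁)` of the spectral curve of `A16`. -/
noncomputable def curveZ (a0 a1 b0 b1 : ℝ) (ζ : ℂ) : ℂ :=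
  (ζ ^ 2 - ((b0 : ℂ) - (b1 : ℂ)) ^ 2) / (4 * (a0 : ℂ) * (a1 : ℂ))

/-- The eigenvalue of `A16` at the point `ζ` of its spectral curve. -/
noncomputable def curveEig (b0 b1 : ℝ) (ζ : ℂ) : ℂ := ((b0 : ℂ) + (b1 : ℂ) + ζ) / 2

/-- A right eigenvector of `A16` at the point `ζ` of its spectral curve. -/
noncomputable def rightEig (a0 b0 b1 : ℝ) (ζ : ℂ) : Fin 2 → ℂ :=
  ![(a0 : ℂ), (ζ + (b1 : ℂ) - (b0 : ℂ)) / 2]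

/-- A left eigenvector of `A16` at the point `ζ` of its spectral curve. -/
noncomputable def leftEig (a0 b0 b1 : ℝ) (ζ : ℂ) : Fin 2 → ℂ :=
  ![(ζ - (b1 : ℂ) + (b0 : ℂ)) / 2, (a0 : ℂ)]

open Polynomial in
theorem curveZ_eq_eval (a0 a1 b0 b1 : ℝ) (ζ : ℂ) :
    curveZ a0 a1 b0 b1 ζ =
      (C (1 / (4 * (a0 : ℂ) * (a1 : ℂ))) * (X ^ 2 - C (((b0 : ℂ) - (b1 : ℂ)) ^ 2))).eval ζ := by
  simp only [curveZ, eval_mul, eval_C, eval_sub, eval_pow, eval_X]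
  ring

@[fun_prop]
theorem continuous_curveZ (a0 a1 b0 b1 : ℝ) : Continuous (curveZ a0 a1 b0 b1) := by
  unfold curveZ; fun_prop

@[fun_prop]
theorem continuous_curveEig (b0 b1 : ℝ) : Continuous (curveEig b0 b1) := by
  unfold curveEig; fun_prop

@[fun_prop]
theorem continuous_rightEig (a0 b0 b1 : ℝ) (i : Fin 2) :
    Continuous fun ζ => rightEig a0 b0 b1 ζ i := by
  unfold rightEig; fin_cases i <;> simp <;> fun_prop

@[fun_prop]
theorem continuous_leftEig (a0 b0 b1 : ℝ) (i : Fin 2) :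
    Continuous fun ζ => leftEig a0 b0 b1 ζ i := by
  unfold leftEig; fin_cases i <;> simp <;> fun_prop

theorem curveZ_ne_zero {a0 a1 b0 b1 ρ : ℝ} (ha0 : 0 < a0) (ha1 : 0 < a1) (hρ : |b0 - b1| < ρ)
    {ζ : ℂ} (hζ : ζ ∈ Metric.sphere (0 : ℂ) ρ) : curveZ a0 a1 b0 b1 ζ ≠ 0 := by
  have h0 : (a0 : ℂ) ≠ 0 := by exact_mod_cast ha0.ne'
  have h1 : (a1 : ℂ) ≠ 0 := by exact_mod_cast ha1.ne'
  have hn : ‖ζ‖ = ρ := by simpa using hζ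
  refine div_ne_zero (sub_ne_zero.2 fun h => ?_) (by simp [h0, h1])
  have h2 : ‖ζ‖ ^ 2 = |b0 - b1| ^ 2 := by
    rw [← norm_pow, h, norm_pow, ← Complex.ofReal_sub, Complex.norm_real, Real.norm_eq_abs]
  rw [hn] at h2
  nlinarith [abs_nonneg (b0 - b1)]

theorem ne_zero_of_mem_sphere_one {z : ℂ} (hz : z ∈ Metric.sphere (0 : ℂ) 1) : z ≠ 0 := by
  rintro rfl
  simp at hz

theorem continuousOn_zpow_sphere_one (j : ℤ) :
    ContinuousOn (fun z : ℂ => z ^ j) (Metric.sphere 0 1) :=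
  ContinuousOn.zpow₀ continuousOn_id j fun _ hz => Or.inl (ne_zero_of_mem_sphere_one hz)

theorem continuousOn_curveZ_zpow {a0 a1 b0 b1 ρ : ℝ} (ha0 : 0 < a0) (ha1 : 0 < a1)
    (hρ : |b0 - b1| < ρ) (j : ℤ) :
    ContinuousOn (fun ζ => curveZ a0 a1 b0 b1 ζ ^ j) (Metric.sphere 0 ρ) :=
  ContinuousOn.zpow₀ (by fun_prop) j fun _ hζ => Or.inl (curveZ_ne_zero ha0 ha1 hρ hζ)

theorem circleIntegral_comp_neg (f : ℂ → ℂ) (ρ : ℝ) :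
    circleIntegral (fun ζ => f (-ζ)) 0 ρ = -circleIntegral f 0 ρ := by
  have key : ∀ θ : ℝ, circleMap 0 ρ (θ + Real.pi) = -circleMap 0 ρ θ := by
    intro θ
    simp [circleMap, add_mul, Complex.exp_add]
  have hper : Function.Periodic (fun θ : ℝ => deriv (circleMap 0 ρ) θ • f (circleMap 0 ρ θ))
      (2 * Real.pi) := by
    intro θ
    simp only [deriv_circleMap, periodic_circleMap (0 : ℂ) ρ θ]
  have h := hper.intervalIntegral_add_eq Real.pi 0
  unfold circleIntegral
  rw [zero_add] at h
  rw [← h, ← intervalIntegral.integral_neg, add_comm Real.pi]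
  have h2 := intervalIntegral.integral_comp_add_right (a := 0) (b := 2 * Real.pi)
    (fun θ : ℝ => -(deriv (circleMap 0 ρ) θ • f (circleMap 0 ρ θ))) Real.pi
  rw [zero_add] at h2
  rw [← h2]
  refine intervalIntegral.integral_congr fun θ _ => ?_
  simp [deriv_circleMap, key]

theorem circleIntegral_sub_comp_neg {f : ℂ → ℂ} {ρ : ℝ} (hρ : 0 ≤ ρ)
    (hf : ContinuousOn f (Metric.sphere 0 ρ)) :
    circleIntegral (fun ζ => f ζ - f (-ζ)) 0 ρ = 2 * circleIntegral f 0 ρ := by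
  rw [circleIntegral.integral_sub (hf.circleIntegrable hρ), circleIntegral_comp_neg]
  · ring
  · refine ContinuousOn.circleIntegrable hρ (hf.comp continuous_neg.continuousOn fun z hz => ?_)
    simpa using hz

/-- Change of variables `z = curveZ ζ` for powers. The curve winds twice around the origin. -/
theorem circleIntegral_zpow_eq {a0 a1 b0 b1 ρ : ℝ} (ha0 : 0 < a0) (ha1 : 0 < a1)
    (hρ : |b0 - b1| < ρ) (j : ℤ) :
    circleIntegral (fun z => z ^ j) 0 1 =
      circleIntegral (fun ζ => 1 / (4 * (a0 : ℂ) * (a1 : ℂ)) * (curveZ a0 a1 b0 b1 ζ ^ j * ζ))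
        0 ρ := by
  have h0 : (a0 : ℂ) ≠ 0 := by exact_mod_cast ha0.ne'
  have h1 : (a1 : ℂ) ≠ 0 := by exact_mod_cast ha1.ne'
  have hρ0 : 0 < ρ := (abs_nonneg _).trans_lt hρ
  by_cases hj : j = -1
  · subst hj
    have hl : circleIntegral (fun z => z ^ (-1 : ℤ)) 0 1 = 2 * (Real.pi : ℂ) * Complex.I := by
      have := circleIntegral.integral_sub_inv_of_mem_ball (c := 0) (w := 0) (R := 1) (by simp)
      simpa using this
    have hb : (b0 : ℂ) - b1 ∈ Metric.ball (0 : ℂ) ρ := by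
      rw [mem_ball_zero_iff, ← Complex.ofReal_sub, Complex.norm_real]; exact hρ
    have hb' : -((b0 : ℂ) - b1) ∈ Metric.ball (0 : ℂ) ρ := by
      simpa only [mem_ball_zero_iff, norm_neg] using hb
    have e1 := circleIntegral.integral_sub_inv_of_mem_ball hb
    have e2 := circleIntegral.integral_sub_inv_of_mem_ball hb'
    have hne : ∀ w ∈ Metric.ball (0 : ℂ) ρ, ∀ z ∈ Metric.sphere (0 : ℂ) ρ, z - w ≠ 0 := by
      intro w hw z hz h
      rw [sub_eq_zero.1 h] at hz
      exact absurd (mem_ball_zero_iff.1 hw) (by rw [mem_sphere_zero_iff_norm.1 hz]; simp)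
    have hi : ∀ w ∈ Metric.ball (0 : ℂ) ρ, CircleIntegrable (fun z => (z - w)⁻¹) 0 ρ := by
      intro w hw
      refine ContinuousOn.circleIntegrable hρ0.le (ContinuousOn.inv₀ (by fun_prop) (hne w hw))
    have hsum := circleIntegral.integral_add (hi _ hb) (hi _ hb')
    rw [e1, e2] at hsum
    rw [hl]
    calc 2 * (Real.pi : ℂ) * Complex.I
        = 1 / 2 * circleIntegral (fun z => (z - ((b0 : ℂ) - b1))⁻¹ +
            (z - -((b0 : ℂ) - b1))⁻¹) 0 ρ := by rw [hsum]; ring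
      _ = _ := by
        rw [← circleIntegral.integral_const_mul]
        refine circleIntegral.integral_congr hρ0.le fun z hz => ?_
        have n1 := hne _ hb z hz
        have n2 := hne _ hb' z hz
        have n3 : z ^ 2 - ((b0 : ℂ) - b1) ^ 2 = (z - ((b0 : ℂ) - b1)) * (z - -((b0 : ℂ) - b1)) := by
          ring
        simp only [curveZ, n3, zpow_neg_one]
        generalize hu : (z - ((b0 : ℂ) - b1)) = u at *
        generalize hv : (z - -((b0 : ℂ) - b1)) = v at *
        have : z = (u + v) / 2 := by rw [← hu, ← hv]; ring
        rw [this]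
        field_simp
        ring
  · have hl : circleIntegral (fun z => z ^ j) 0 1 = 0 := by
      simpa using circleIntegral.integral_sub_zpow_of_ne hj 0 0 1
    have hj' : ((j : ℂ) + 1) ≠ 0 := by
      intro h; apply hj; have : ((j + 1 : ℤ) : ℂ) = 0 := by push_cast; exact h
      have := Int.cast_eq_zero.1 this; omega
    rw [hl, eq_comm]
    refine circleIntegral.integral_eq_zero_of_hasDerivWithinAt
      (f := fun ζ => 1 / (2 * ((j : ℂ) + 1)) * curveZ a0 a1 b0 b1 ζ ^ (j + 1)) hρ0.le
      fun z hz => ?_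
    have hd : HasDerivAt (curveZ a0 a1 b0 b1) (2 * z / (4 * (a0 : ℂ) * (a1 : ℂ))) z := by
      have := (((hasDerivAt_id z).pow 2).sub_const (((b0 : ℂ) - b1) ^ 2)).div_const
        (4 * (a0 : ℂ) * (a1 : ℂ))
      unfold curveZ
      exact this.congr_deriv (by simp)
    have hd2 := ((hasDerivAt_zpow (j + 1) _ (Or.inl (curveZ_ne_zero ha0 ha1 hρ hz))).comp z
      hd).const_mul (1 / (2 * ((j : ℂ) + 1)))
    refine (HasDerivAt.congr_deriv hd2 ?_).hasDerivWithinAt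
    rw [show j + 1 - 1 = j by ring]
    push_cast
    field_simp

/-- Change of variables `z = curveZ ζ` for Laurent polynomials. -/
theorem circleIntegral_zpow_mul_eval {a0 a1 b0 b1 ρ : ℝ} (ha0 : 0 < a0) (ha1 : 0 < a1)
    (hρ : |b0 - b1| < ρ) (j : ℤ) (G : Polynomial ℂ) :
    circleIntegral (fun z => z ^ j * G.eval z) 0 1 =
      circleIntegral (fun ζ => 1 / (4 * (a0 : ℂ) * (a1 : ℂ)) *
        (curveZ a0 a1 b0 b1 ζ ^ j * G.eval (curveZ a0 a1 b0 b1 ζ) * ζ)) 0 ρ := by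
  have hρ0 : 0 ≤ ρ := (abs_nonneg _).trans hρ.le
  induction G using Polynomial.induction_on' with
  | add p q hp hq =>
    have c1 := continuousOn_zpow_sphere_one j
    have c2 := continuousOn_curveZ_zpow ha0 ha1 hρ j
    simp only [Polynomial.eval_add, mul_add, add_mul]
    rw [circleIntegral.integral_add, circleIntegral.integral_add, hp, hq]
    · exact ContinuousOn.circleIntegrable hρ0 (by fun_prop (disch := assumption))
    · exact ContinuousOn.circleIntegrable hρ0 (by fun_prop (disch := assumption))
    · exact ContinuousOn.circleIntegrable zero_le_one (by fun_prop)
    · exact ContinuousOn.circleIntegrable zero_le_one (by fun_prop)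
  | monomial k c =>
    have h := circleIntegral_zpow_eq ha0 ha1 hρ (j + k)
    calc circleIntegral (fun z => z ^ j * (Polynomial.monomial k c).eval z) 0 1
        = c * circleIntegral (fun z => z ^ (j + k)) 0 1 := by
          rw [← circleIntegral.integral_const_mul]
          refine circleIntegral.integral_congr zero_le_one fun z hz => ?_
          have := ne_zero_of_mem_sphere_one hz
          simp only [Polynomial.eval_monomial, zpow_add₀ this, zpow_natCast]
          ring
      _ = _ := by
          rw [h, ← circleIntegral.integral_const_mul]
          refine circleIntegral.integral_congr hρ0 fun z hz => ?_
          simp only [Polynomial.eval_monomial, zpow_add₀ (curveZ_ne_zero ha0 ha1 hρ hz),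
            zpow_natCast]
          ring

theorem A16_mul_rightEig {a0 a1 b0 b1 : ℝ} (ha0 : 0 < a0) (ha1 : 0 < a1) (ζ : ℂ) (i : Fin 2) :
    ∑ j, A16 a0 a1 b0 b1 (curveZ a0 a1 b0 b1 ζ) i j * rightEig a0 b0 b1 ζ j =
      curveEig b0 b1 ζ * rightEig a0 b0 b1 ζ i := by
  have h0 : (a0 : ℂ) ≠ 0 := by exact_mod_cast ha0.ne'
  have h1 : (a1 : ℂ) ≠ 0 := by exact_mod_cast ha1.ne'
  fin_cases i <;> simp [A16, rightEig, curveEig, curveZ] <;> field_simp <;> ring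

/-- The spectral decomposition of the powers of `A16` on its spectral curve. -/
theorem mul_A16_pow_apply {a0 a1 b0 b1 : ℝ} (ha0 : 0 < a0) (ha1 : 0 < a1) (ζ : ℂ) (k : ℕ)
    (i j : Fin 2) :
    ζ * (A16 a0 a1 b0 b1 (curveZ a0 a1 b0 b1 ζ) ^ k) i j =
      1 / (a0 : ℂ) * (curveEig b0 b1 ζ ^ k * rightEig a0 b0 b1 ζ i * leftEig a0 b0 b1 ζ j) -
      1 / (a0 : ℂ) *
        (curveEig b0 b1 (-ζ) ^ k * rightEig a0 b0 b1 (-ζ) i * leftEig a0 b0 b1 (-ζ) j) := by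
  have h0 : (a0 : ℂ) ≠ 0 := by exact_mod_cast ha0.ne'
  induction k generalizing i with
  | zero =>
    fin_cases i <;> fin_cases j <;> simp [rightEig, leftEig] <;> field_simp <;> ring
  | succ k ih =>
    have e1 := A16_mul_rightEig (b0 := b0) (b1 := b1) ha0 ha1 ζ i
    have e2 := A16_mul_rightEig (b0 := b0) (b1 := b1) ha0 ha1 (-ζ) i
    have hz : curveZ a0 a1 b0 b1 (-ζ) = curveZ a0 a1 b0 b1 ζ := by simp [curveZ]
    rw [hz] at e2
    have i0 := ih 0
    have i1 := ih 1
    rw [Fin.sum_univ_two] at e1 e2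
    rw [pow_succ', Matrix.mul_apply, Fin.sum_univ_two]
    set A := A16 a0 a1 b0 b1 (curveZ a0 a1 b0 b1 ζ)
    linear_combination A i 0 * i0 + A i 1 * i1 +
      1 / (a0 : ℂ) * curveEig b0 b1 ζ ^ k * leftEig a0 b0 b1 ζ j * e1 -
      1 / (a0 : ℂ) * curveEig b0 b1 (-ζ) ^ k * leftEig a0 b0 b1 (-ζ) j * e2

open Polynomial in
theorem exists_polynomial_A16_pow (a0 a1 b0 b1 : ℝ) (k : ℕ) (i j : Fin 2) :
    ∃ q : ℂ[X], ∀ z, (A16 a0 a1 b0 b1 z ^ k) i j = q.eval z := by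
  let B : Matrix (Fin 2) (Fin 2) ℂ[X] := !![C (b0 : ℂ), C (a0 : ℂ); C (a1 : ℂ) * X, C (b1 : ℂ)]
  refine ⟨(B ^ k) i j, fun z => ?_⟩
  have hB : A16 a0 a1 b0 b1 z = (evalRingHom z).mapMatrix B := by
    ext i j
    fin_cases i <;> fin_cases j <;> simp [A16, B]
  rw [hB, ← map_pow]
  simp

theorem continuousOn_A16_integrand (a0 a1 b0 b1 : ℝ) (s : ℤ) (G : Polynomial ℂ) (k : ℕ)
    (i j : Fin 2) :
    ContinuousOn (fun z => z ^ s * G.eval z * (A16 a0 a1 b0 b1 z ^ k) i j)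
      (Metric.sphere 0 1) := by
  obtain ⟨q, hq⟩ := exists_polynomial_A16_pow a0 a1 b0 b1 k i j
  have c1 := continuousOn_zpow_sphere_one s
  simp only [hq]
  fun_prop

theorem continuousOn_curve_integrand {a0 a1 b0 b1 ρ : ℝ} (ha0 : 0 < a0) (ha1 : 0 < a1)
    (hρ : |b0 - b1| < ρ) (s : ℤ) (G : Polynomial ℂ) (k : ℕ) (i j : Fin 2) :
    ContinuousOn (fun ζ => 1 / (2 * (a0 : ℂ) * (a1 : ℂ)) * (1 / (a0 : ℂ)) *
        (curveZ a0 a1 b0 b1 ζ ^ s * G.eval (curveZ a0 a1 b0 b1 ζ) * curveEig b0 b1 ζ ^ k *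
          rightEig a0 b0 b1 ζ i * leftEig a0 b0 b1 ζ j)) (Metric.sphere 0 ρ) := by
  have c2 := continuousOn_curveZ_zpow ha0 ha1 hρ s
  fun_prop

/-- Contour integrals against powers of `A16` as contour integrals on its spectral curve. -/
theorem circleIntegral_A16_pow {a0 a1 b0 b1 ρ : ℝ} (ha0 : 0 < a0) (ha1 : 0 < a1)
    (hρ : |b0 - b1| < ρ) (s : ℤ) (G : Polynomial ℂ) (k : ℕ) (i j : Fin 2) :
    circleIntegral (fun z => z ^ s * G.eval z * (A16 a0 a1 b0 b1 z ^ k) i j) 0 1 =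
      circleIntegral (fun ζ => 1 / (2 * (a0 : ℂ) * (a1 : ℂ)) * (1 / (a0 : ℂ)) *
        (curveZ a0 a1 b0 b1 ζ ^ s * G.eval (curveZ a0 a1 b0 b1 ζ) * curveEig b0 b1 ζ ^ k *
          rightEig a0 b0 b1 ζ i * leftEig a0 b0 b1 ζ j)) 0 ρ := by
  have hρ0 : 0 ≤ ρ := (abs_nonneg _).trans hρ.le
  obtain ⟨q, hq⟩ := exists_polynomial_A16_pow a0 a1 b0 b1 k i j
  set F : ℂ → ℂ := fun ζ => 1 / (2 * (a0 : ℂ) * (a1 : ℂ)) * (1 / (a0 : ℂ)) *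
        (curveZ a0 a1 b0 b1 ζ ^ s * G.eval (curveZ a0 a1 b0 b1 ζ) * curveEig b0 b1 ζ ^ k *
          rightEig a0 b0 b1 ζ i * leftEig a0 b0 b1 ζ j) with hF
  have hFc : ContinuousOn F (Metric.sphere 0 ρ) :=
    continuousOn_curve_integrand ha0 ha1 hρ s G k i j
  calc _ = circleIntegral (fun z => z ^ s * (G * q).eval z) 0 1 := by
        congr 1; funext z; rw [hq, Polynomial.eval_mul, mul_assoc]
    _ = circleIntegral (fun ζ => (1 / 2) * (F ζ - F (-ζ))) 0 ρ := by
        rw [circleIntegral_zpow_mul_eval ha0 ha1 hρ]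
        congr 1; funext ζ
        have h := mul_A16_pow_apply (b0 := b0) (b1 := b1) ha0 ha1 ζ k i j
        have hz : curveZ a0 a1 b0 b1 (-ζ) = curveZ a0 a1 b0 b1 ζ := by simp [curveZ]
        rw [hq] at h
        simp only [hF, hz, Polynomial.eval_mul]
        linear_combination (1 / (4 * (a0 : ℂ) * (a1 : ℂ)) * curveZ a0 a1 b0 b1 ζ ^ s *
          G.eval (curveZ a0 a1 b0 b1 ζ)) * h
    _ = _ := by
        rw [circleIntegral.integral_const_mul, circleIntegral_sub_comp_neg hρ0 hFc]
        ring

open Polynomial in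
theorem isPolyDeg_iff {d : ℕ} {f : ℂ → ℂ} :
    IsPolyDeg d f ↔ ∃ P : ℂ[X], P.natDegree ≤ d ∧ ∀ z, f z = P.eval z := by
  constructor
  · rintro ⟨c, hc⟩
    refine ⟨∑ ℓ ∈ Finset.range (d + 1), C (c ℓ) * X ^ ℓ, ?_, fun z => ?_⟩
    · refine natDegree_sum_le_of_forall_le _ _ fun i hi => (natDegree_C_mul_X_pow_le _ _).trans ?_
      have := Finset.mem_range.1 hi
      omega
    · rw [hc, eval_finsetSum]
      simp
  · rintro ⟨P, hP, h⟩
    exact ⟨P.coeff, fun z => by rw [h, eval_eq_sum_range' (Nat.lt_succ_of_le hP)]⟩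

theorem IsPolyDeg.const_mul {d : ℕ} {f : ℂ → ℂ} (hf : IsPolyDeg d f) (c : ℂ) :
    IsPolyDeg d fun z => c * f z := by
  obtain ⟨a, ha⟩ := hf
  exact ⟨fun i => c * a i, fun z => by simp only [ha, Finset.mul_sum, mul_assoc]⟩

theorem IsPolyDeg.add {d : ℕ} {f g : ℂ → ℂ} (hf : IsPolyDeg d f) (hg : IsPolyDeg d g) :
    IsPolyDeg d fun z => f z + g z := by
  obtain ⟨a, ha⟩ := hf
  obtain ⟨b, hb⟩ := hg
  exact ⟨fun i => a i + b i, fun z => by simp only [ha, hb, add_mul, Finset.sum_add_distrib]⟩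

theorem IsMatPoly.apply {m n d : ℕ} {P : ℂ → Matrix (Fin m) (Fin n) ℂ} (hP : IsMatPoly m n d P)
    (i : Fin m) (j : Fin n) : IsPolyDeg d fun z => P z i j := by
  obtain ⟨C, hC⟩ := hP
  exact ⟨fun ℓ => C ℓ i j, fun z => by simp [hC, Matrix.sum_apply, mul_comm]⟩

theorem isMatPoly_of_apply {m n d : ℕ} {P : ℂ → Matrix (Fin m) (Fin n) ℂ}
    (hP : ∀ i j, IsPolyDeg d fun z => P z i j) : IsMatPoly m n d P := by
  choose c hc using hP
  refine ⟨fun ℓ => Matrix.of fun i j => c i j ℓ, fun z => ?_⟩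
  ext i j
  simp [hc, Matrix.sum_apply, mul_comm]

open Polynomial in
theorem IsPolyDeg.comp_linear {d : ℕ} {f : ℂ → ℂ} (hf : IsPolyDeg d f) (α β : ℂ) :
    IsPolyDeg d fun z => f (α * z + β) := by
  obtain ⟨P, hP, h⟩ := isPolyDeg_iff.1 hf
  refine isPolyDeg_iff.2 ⟨P.comp (C α * X + C β), ?_, fun z => by simp [h]⟩
  refine natDegree_comp_le.trans ?_
  have := natDegree_linear_le (a := α) (b := β)
  nlinarith

open Polynomial in
theorem IsPolyDeg.linear_mul_comp_curveZ {d : ℕ} {f : ℂ → ℂ} (hf : IsPolyDeg d f)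
    (a0 a1 b0 b1 : ℝ) (α β : ℂ) :
    IsPolyDeg (2 * d + 1) fun z => (α * z + β) * f (curveZ a0 a1 b0 b1 z) := by
  obtain ⟨P, hP, h⟩ := isPolyDeg_iff.1 hf
  refine isPolyDeg_iff.2 ⟨(C α * X + C β) * P.comp (C (1 / (4 * (a0 : ℂ) * (a1 : ℂ))) *
    (X ^ 2 - C (((b0 : ℂ) - (b1 : ℂ)) ^ 2))), ?_, fun z => ?_⟩
  · have h1 := natDegree_linear_le (a := α) (b := β)
    have h2 : (C (1 / (4 * (a0 : ℂ) * (a1 : ℂ))) *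
        (X ^ 2 - C (((b0 : ℂ) - (b1 : ℂ)) ^ 2)) : ℂ[X]).natDegree ≤ 2 := by
      refine (natDegree_C_mul_le _ _).trans ?_
      rw [natDegree_X_pow_sub_C]
    refine natDegree_mul_le.trans ?_
    have h3 := (natDegree_comp_le (p := P)).trans (Nat.mul_le_mul hP h2)
    omega
  · rw [eval_mul, eval_comp, ← curveZ_eq_eval, ← h]
    simp

theorem IsPolyDeg.leftEig_mul_comp_curveZ {d : ℕ} {f : ℂ → ℂ} (hf : IsPolyDeg d f)
    (a0 a1 b0 b1 : ℝ) (i : Fin 2) :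
    IsPolyDeg (2 * d + 1) fun z => leftEig a0 b0 b1 z i * f (curveZ a0 a1 b0 b1 z) := by
  fin_cases i
  · convert hf.linear_mul_comp_curveZ a0 a1 b0 b1 (1 / 2) ((b0 - b1) / 2) using 3
    simp [leftEig]; ring
  · convert hf.linear_mul_comp_curveZ a0 a1 b0 b1 0 a0 using 3
    simp [leftEig]

theorem IsPolyDeg.rightEig_mul_comp_curveZ {d : ℕ} {f : ℂ → ℂ} (hf : IsPolyDeg d f)
    (a0 a1 b0 b1 : ℝ) (i : Fin 2) :
    IsPolyDeg (2 * d + 1) fun z => rightEig a0 b0 b1 z i * f (curveZ a0 a1 b0 b1 z) := by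
  fin_cases i
  · convert hf.linear_mul_comp_curveZ a0 a1 b0 b1 0 a0 using 3
    simp [rightEig]
  · convert hf.linear_mul_comp_curveZ a0 a1 b0 b1 (1 / 2) ((b1 - b0) / 2) using 3
    simp [rightEig]; ring

/-- Scalar polynomials on the spectral curve are row vector polynomials paired with the right
eigenvector. -/
theorem IsPolyDeg.exists_eq_sum_rightEig {d : ℕ} {p : ℂ → ℂ} (hp : IsPolyDeg (2 * d + 1) p)
    {a0 a1 : ℝ} (ha0 : 0 < a0) (ha1 : 0 < a1) (b0 b1 : ℝ) :
    ∃ q : Fin 2 → ℂ → ℂ, (∀ j, IsPolyDeg d (q j)) ∧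
      ∀ ω, p ω = ∑ j, q j (curveZ a0 a1 b0 b1 ω) * rightEig a0 b0 b1 ω j := by
  have h0 : (a0 : ℂ) ≠ 0 := by exact_mod_cast ha0.ne'
  have h1 : (a1 : ℂ) ≠ 0 := by exact_mod_cast ha1.ne'
  obtain ⟨c, hc⟩ := hp
  have hsplit : ∀ ω : ℂ, ∀ k : ℕ, ∑ ℓ ∈ Finset.range (2 * k), c ℓ * ω ^ ℓ =
      ∑ i ∈ Finset.range k, c (2 * i) * (ω ^ 2) ^ i +
        ω * ∑ i ∈ Finset.range k, c (2 * i + 1) * (ω ^ 2) ^ i := by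
    intro ω k
    induction k with
    | zero => simp
    | succ k ih =>
      rw [Nat.mul_succ, Finset.sum_range_succ, Finset.sum_range_succ, ih, Finset.sum_range_succ,
        Finset.sum_range_succ]
      ring
  let lin : ℂ → ℂ := fun w => 4 * (a0 : ℂ) * (a1 : ℂ) * w + ((b0 : ℂ) - b1) ^ 2
  let E : ℂ → ℂ := fun w => ∑ i ∈ Finset.range (d + 1), c (2 * i) * lin w ^ i
  let O : ℂ → ℂ := fun w => ∑ i ∈ Finset.range (d + 1), c (2 * i + 1) * lin w ^ i
  have hE : IsPolyDeg d E := IsPolyDeg.comp_linear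
    (f := fun w => ∑ i ∈ Finset.range (d + 1), c (2 * i) * w ^ i) ⟨_, fun z => rfl⟩ _ _
  have hO : IsPolyDeg d O := IsPolyDeg.comp_linear
    (f := fun w => ∑ i ∈ Finset.range (d + 1), c (2 * i + 1) * w ^ i) ⟨_, fun z => rfl⟩ _ _
  have hlin : ∀ ω, lin (curveZ a0 a1 b0 b1 ω) = ω ^ 2 := by
    intro ω
    simp only [lin, curveZ]
    field_simp
    ring
  refine ⟨![fun w => 1 / (a0 : ℂ) * E w + -(((b1 : ℂ) - b0) / a0) * O w, fun w => 2 * O w],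
    fun j => ?_, fun ω => ?_⟩
  · fin_cases j
    · exact (hE.const_mul _).add (hO.const_mul _)
    · exact hO.const_mul _
  · rw [hc, show 2 * d + 1 + 1 = 2 * (d + 1) by ring, hsplit]
    simp only [Fin.sum_univ_two, rightEig, Matrix.cons_val_zero, Matrix.cons_val_one, E, O, hlin]
    field_simp
    ring

/-- Interpolation in the second variable, at nodes that do not depend on the function. -/
theorem exists_eq_sum_mul_of_isPolyDeg (d : ℕ) :
    ∃ Q : ℕ → Polynomial ℂ, ∀ F : ℂ → ℂ → ℂ, (∀ w, IsPolyDeg d (F w)) →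
      ∀ w z, F w z = ∑ i ∈ Finset.range (d + 1), F w i * (Q i).eval z := by
  refine ⟨Lagrange.basis (Finset.range (d + 1)) (fun i : ℕ => (i : ℂ)), fun F hF w z => ?_⟩
  obtain ⟨P, hP, h⟩ := isPolyDeg_iff.1 (hF w)
  have hinj : Set.InjOn (fun i : ℕ => (i : ℂ)) (Finset.range (d + 1)) :=
    Nat.cast_injective.injOn
  have hdeg : P.degree < (Finset.range (d + 1)).card := by
    rw [Finset.card_range]
    exact (Polynomial.degree_le_of_natDegree_le hP).trans_lt (by exact_mod_cast Nat.lt_succ_self d)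
  have := congrArg (Polynomial.eval z) (Lagrange.eq_interpolate hinj hdeg)
  rw [Lagrange.interpolate_apply, Polynomial.eval_finsetSum] at this
  rw [h, this]
  simp [h]

theorem circleIntegral_circleIntegral_sum_mul {ι : Type*} (s : Finset ι) {f g : ι → ℂ → ℂ} {ρ : ℝ}
    (hρ : 0 ≤ ρ) (hf : ∀ i ∈ s, ContinuousOn (f i) (Metric.sphere 0 ρ))
    (hg : ∀ i ∈ s, ContinuousOn (g i) (Metric.sphere 0 ρ)) :
    circleIntegral (fun w => circleIntegral (fun z => ∑ i ∈ s, f i w * g i z) 0 ρ) 0 ρ =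
      ∑ i ∈ s, circleIntegral (f i) 0 ρ * circleIntegral (g i) 0 ρ := by
  have h : ∀ w, circleIntegral (fun z => ∑ i ∈ s, f i w * g i z) 0 ρ =
      ∑ i ∈ s, circleIntegral (g i) 0 ρ * f i w := by
    intro w
    rw [circleIntegral.integral_fun_sum (f := fun i z => f i w * g i z) fun i hi =>
      ContinuousOn.circleIntegrable hρ (continuousOn_const.mul (hg i hi))]
    refine Finset.sum_congr rfl fun i _ => ?_
    rw [circleIntegral.integral_const_mul, mul_comm]
  simp only [h]
  rw [circleIntegral.integral_fun_sum (f := fun i w => circleIntegral (g i) 0 ρ * f i w)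
    fun i hi => ContinuousOn.circleIntegrable hρ (continuousOn_const.mul (hf i hi))]
  refine Finset.sum_congr rfl fun i _ => ?_
  rw [circleIntegral.integral_const_mul, mul_comm]

/-- The pullback of a matrix kernel to the spectral curve of `A16`. -/
noncomputable def curveKernel (a0 a1 b0 b1 : ℝ) (K : ℂ → ℂ → Matrix (Fin 2) (Fin 2) ℂ)
    (ω ζ : ℂ) : ℂ :=
  1 / (a0 : ℂ) * ∑ c, ∑ d, leftEig a0 b0 b1 ω c *
    K (curveZ a0 a1 b0 b1 ω) (curveZ a0 a1 b0 b1 ζ) c d * rightEig a0 b0 b1 ζ d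

theorem scalW16_eq (a0 a1 b0 b1 : ℝ) (m n L : ℕ) (ω : ℂ) :
    scalW16 a0 a1 b0 b1 m n L ω = 1 / (2 * (a0 : ℂ) * (a1 : ℂ)) * curveEig b0 b1 ω ^ L *
      curveZ a0 a1 b0 b1 ω ^ (-((m + n : ℕ) : ℤ)) := by
  rw [scalW16, curveEig, curveZ, zpow_neg, zpow_natCast, ← inv_pow, inv_div]

/-- The pullback of a matrix reproducing kernel is a scalar reproducing kernel. -/
theorem isLeftRKCircleS_curveKernel {a0 a1 b0 b1 ρ : ℝ} (ha0 : 0 < a0) (ha1 : 0 < a1)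
    (hρ : |b0 - b1| < ρ) {m n L : ℕ} (hn : 1 ≤ n) {K : ℂ → ℂ → Matrix (Fin 2) (Fin 2) ℂ}
    (hK : IsLeftRKCircleM 2 n 1
      (fun z => z ^ (-((m + n : ℕ) : ℤ)) • A16 a0 a1 b0 b1 z ^ L) K) :
    IsLeftRKCircleS (2 * n) ρ (scalW16 a0 a1 b0 b1 m n L) (curveKernel a0 a1 b0 b1 K) := by
  have hρ0 : 0 ≤ ρ := (abs_nonneg _).trans hρ.le
  obtain ⟨hK1, hK2, hK3⟩ := hK
  have hdeg : 2 * n - 1 = 2 * (n - 1) + 1 := by omega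
  unfold IsLeftRKCircleS
  rw [hdeg]
  refine ⟨fun ζ => ?_, fun ω => ?_, fun p hp ζ => ?_⟩
  · have h : ∀ c d, IsPolyDeg (2 * (n - 1) + 1) fun ω => rightEig a0 b0 b1 ζ d *
        (leftEig a0 b0 b1 ω c * K (curveZ a0 a1 b0 b1 ω) (curveZ a0 a1 b0 b1 ζ) c d) :=
      fun c d => (((hK1 _).apply c d).leftEig_mul_comp_curveZ a0 a1 b0 b1 c).const_mul _
    convert ((((h 0 0).add (h 0 1)).add (h 1 0)).add (h 1 1)).const_mul (1 / (a0 : ℂ)) using 2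
    simp only [curveKernel, Fin.sum_univ_two]
    ring
  · have h : ∀ c d, IsPolyDeg (2 * (n - 1) + 1) fun ζ => leftEig a0 b0 b1 ω c *
        (rightEig a0 b0 b1 ζ d * K (curveZ a0 a1 b0 b1 ω) (curveZ a0 a1 b0 b1 ζ) c d) :=
      fun c d => (((hK2 _).apply c d).rightEig_mul_comp_curveZ a0 a1 b0 b1 d).const_mul _
    convert ((((h 0 0).add (h 0 1)).add (h 1 0)).add (h 1 1)).const_mul (1 / (a0 : ℂ)) using 2
    simp only [curveKernel, Fin.sum_univ_two]
    ring
  · obtain ⟨q, hq, hpq⟩ := hp.exists_eq_sum_rightEig ha0 ha1 b0 b1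
    set s : ℤ := -((m + n : ℕ) : ℤ) with hs
    set z := curveZ a0 a1 b0 b1 ζ with hz
    choose Q _ hQ using fun j => isPolyDeg_iff.1 (hq j)
    choose P _ hP using fun c d => isPolyDeg_iff.1 ((hK1 z).apply c d)
    have hrep : ∀ d, ∑ x : Fin 2 × Fin 2, circleIntegral (fun w => w ^ s *
        (Q x.1 * P x.2 d).eval w * (A16 a0 a1 b0 b1 w ^ L) x.1 x.2) 0 1 = q d z := by
      intro d
      have h := hK3 (fun w => Matrix.of ![fun j => q j w, 0]) (isMatPoly_of_apply fun i j => by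
        fin_cases i
        · exact hq j
        · exact ⟨0, fun z => by simp⟩) z
      have h' := congrFun (congrFun h 0) d
      simp only [circleIntegralM, Matrix.of_apply, Matrix.cons_val_zero] at h'
      rw [← h', ← circleIntegral.integral_fun_sum fun x _ =>
        ContinuousOn.circleIntegrable zero_le_one
          (continuousOn_A16_integrand a0 a1 b0 b1 s _ L x.1 x.2)]
      congr 1
      funext w
      simp only [Matrix.mul_apply, Fintype.sum_prod_type, Fin.sum_univ_two, Matrix.smul_apply,
        Matrix.of_apply, Matrix.cons_val_zero, Polynomial.eval_mul, ← hP, ← hQ, smul_eq_mul]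
      ring
    let f : Fin 2 × Fin 2 × Fin 2 → ℂ → ℂ := fun y ω => 1 / (2 * (a0 : ℂ) * (a1 : ℂ)) *
      (1 / (a0 : ℂ)) * (curveZ a0 a1 b0 b1 ω ^ s *
        (Q y.2.1 * P y.2.2 y.1).eval (curveZ a0 a1 b0 b1 ω) * curveEig b0 b1 ω ^ L *
        rightEig a0 b0 b1 ω y.2.1 * leftEig a0 b0 b1 ω y.2.2)
    have hf : ∀ y, ContinuousOn (f y) (Metric.sphere 0 ρ) := fun y =>
      continuousOn_curve_integrand ha0 ha1 hρ s (Q y.2.1 * P y.2.2 y.1) L y.2.1 y.2.2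
    have hrep' : ∀ d, ∑ x : Fin 2 × Fin 2, circleIntegral (f (d, x)) 0 ρ = q d z := fun d => by
      rw [← hrep d]
      exact Finset.sum_congr rfl fun x _ => (circleIntegral_A16_pow ha0 ha1 hρ _ _ _ _ _).symm
    calc _ = circleIntegral (fun ω => ∑ y, rightEig a0 b0 b1 ζ y.1 * f y ω) 0 ρ := by
          congr 1
          funext ω
          simp only [scalW16_eq, ← hs, hpq ω, curveKernel, ← hz, Fintype.sum_prod_type,
            Fin.sum_univ_two, Polynomial.eval_mul, hP, hQ, f]
          ring
      _ = ∑ y, rightEig a0 b0 b1 ζ y.1 * circleIntegral (f y) 0 ρ := by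
          rw [circleIntegral.integral_fun_sum (f := fun y ω => rightEig a0 b0 b1 ζ y.1 * f y ω)
            fun y _ => ContinuousOn.circleIntegrable hρ0 (continuousOn_const.mul (hf y))]
          simp only [circleIntegral.integral_const_mul]
      _ = p ζ := by
          rw [hpq ζ, Fintype.sum_prod_type]
          simp only [← Finset.mul_sum, hrep', ← hz, mul_comm]

theorem circleIntegralM_apply {m n : ℕ} (ρ : ℝ) (F : ℂ → Matrix (Fin m) (Fin n) ℂ) (i : Fin m)
    (j : Fin n) : circleIntegralM ρ F i j = circleIntegral (fun z => F z i j) 0 ρ := rfl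

/-- Double contour integrals against a matrix kernel as double contour integrals on the spectral
curve of `A16`. -/
theorem circleIntegral_circleIntegral_kernel {a0 a1 b0 b1 ρ : ℝ} (ha0 : 0 < a0) (ha1 : 0 < a1)
    (hρ : |b0 - b1| < ρ) {N : ℕ} {K : ℂ → ℂ → Matrix (Fin 2) (Fin 2) ℂ}
    (hK1 : ∀ z, IsMatPoly 2 2 N fun w => K w z) (hK2 : ∀ w, IsMatPoly 2 2 N fun z => K w z)
    (s t : ℤ) (k l : ℕ) (a b : Fin 2) :
    circleIntegral (fun w => circleIntegral (fun z => w ^ s * z ^ t *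
      (A16 a0 a1 b0 b1 w ^ k * K w z * A16 a0 a1 b0 b1 z ^ l) a b) 0 1) 0 1 =
    circleIntegral (fun ω => circleIntegral (fun ζ =>
      (1 / (2 * (a0 : ℂ) * (a1 : ℂ))) ^ 2 * (curveKernel a0 a1 b0 b1 K ω ζ *
        curveEig b0 b1 ζ ^ l * curveEig b0 b1 ω ^ k * curveZ a0 a1 b0 b1 ζ ^ t *
        curveZ a0 a1 b0 b1 ω ^ s * (1 / (a0 : ℂ) *
          (rightEig a0 b0 b1 ω a * leftEig a0 b0 b1 ζ b)))) 0 ρ) 0 ρ := by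
  have hρ0 : 0 ≤ ρ := (abs_nonneg _).trans hρ.le
  obtain ⟨Q, hQ⟩ := exists_eq_sum_mul_of_isPolyDeg N
  choose P _ hP using fun (i : ℕ) c d => isPolyDeg_iff.1 ((hK1 (i : ℂ)).apply c d)
  have hKe : ∀ c d w z, K w z c d = ∑ i ∈ Finset.range (N + 1), (P i c d).eval w * (Q i).eval z := by
    intro c d w z
    rw [hQ (fun w z => K w z c d) (fun w => (hK2 w).apply c d) w z]
    simp only [hP]
  have hl := circleIntegral_circleIntegral_sum_mul
    ((Finset.range (N + 1)) ×ˢ (Finset.univ : Finset (Fin 2 × Fin 2)))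
    (f := fun x w => w ^ s * (P x.1 x.2.1 x.2.2).eval w * (A16 a0 a1 b0 b1 w ^ k) a x.2.1)
    (g := fun x z => z ^ t * (Q x.1).eval z * (A16 a0 a1 b0 b1 z ^ l) x.2.2 b) zero_le_one
    (fun _ _ => continuousOn_A16_integrand _ _ _ _ _ _ _ _ _) (fun _ _ => continuousOn_A16_integrand _ _ _ _ _ _ _ _ _)
  have hr := circleIntegral_circleIntegral_sum_mul
    ((Finset.range (N + 1)) ×ˢ (Finset.univ : Finset (Fin 2 × Fin 2)))
    (f := fun x ζ => 1 / (2 * (a0 : ℂ) * (a1 : ℂ)) * (1 / (a0 : ℂ)) *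
        (curveZ a0 a1 b0 b1 ζ ^ s * (P x.1 x.2.1 x.2.2).eval (curveZ a0 a1 b0 b1 ζ) *
          curveEig b0 b1 ζ ^ k * rightEig a0 b0 b1 ζ a * leftEig a0 b0 b1 ζ x.2.1))
    (g := fun x ζ => 1 / (2 * (a0 : ℂ) * (a1 : ℂ)) * (1 / (a0 : ℂ)) *
        (curveZ a0 a1 b0 b1 ζ ^ t * (Q x.1).eval (curveZ a0 a1 b0 b1 ζ) * curveEig b0 b1 ζ ^ l *
          rightEig a0 b0 b1 ζ x.2.2 * leftEig a0 b0 b1 ζ b)) hρ0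
    (fun _ _ => continuousOn_curve_integrand ha0 ha1 hρ _ _ _ _ _)
    (fun _ _ => continuousOn_curve_integrand ha0 ha1 hρ _ _ _ _ _)
  simp only [circleIntegral_A16_pow ha0 ha1 hρ] at hl
  rw [← hr] at hl
  convert hl using 6 with w z ω ζ
  · simp only [Finset.sum_product, Fintype.sum_prod_type, Fin.sum_univ_two, Matrix.mul_apply,
      hKe, Finset.mul_sum, Finset.sum_mul, ← Finset.sum_add_distrib]
    exact Finset.sum_congr rfl fun i _ => by ring
  · simp only [Finset.sum_product, Fintype.sum_prod_type, Fin.sum_univ_two, curveKernel,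
      hKe, Finset.mul_sum, Finset.sum_mul, ← Finset.sum_add_distrib]
    exact Finset.sum_congr rfl fun i _ => by ring

/-- The correlation kernel of a lozenge tiling model with a `2 × 1`
periodic weighting: the matrix-valued double contour integral formula equals a formula
involving only the scalar reproducing kernel `𝒦` for the weight `𝒲` on the circle of
radius `ρ`. -/
theorem stmt16 (a0 a1 b0 b1 : ℝ) (ha0 : 0 < a0) (ha1 : 0 < a1) (hb0 : 0 < b0) (hb1 : 0 < b1)
    (m n L M N : ℕ) (hm : 1 ≤ m) (hn : 1 ≤ n) (hL : 2 ≤ L) (hM : M = 2 * m) (hN : N = 2 * n)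
    (ρ : ℝ) (hρ : |b0 - b1| < ρ)
    (K : ℂ → ℂ → Matrix (Fin 2) (Fin 2) ℂ)
    (hK : IsLeftRKCircleM 2 n 1
      (fun z => z ^ (-((m + n : ℕ) : ℤ)) • A16 a0 a1 b0 b1 z ^ L) K)
    (Ks : ℂ → ℂ → ℂ)
    (hKs : IsLeftRKCircleS (2 * n) ρ (scalW16 a0 a1 b0 b1 m n L) Ks)
    (hKsU : ∀ Ks' : ℂ → ℂ → ℂ,
      IsLeftRKCircleS (2 * n) ρ (scalW16 a0 a1 b0 b1 m n L) Ks' → Ks' = Ks)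
    (x₁ x₂ y₁ y₂ : ℤ)
    (hx₁ : 1 ≤ x₁ ∧ x₁ ≤ (L : ℤ) - 1) (hx₂ : 1 ≤ x₂ ∧ x₂ ≤ (L : ℤ) - 1) :
    -((if x₂ < x₁ then (1 : ℂ) else 0) / (2 * (Real.pi : ℂ) * Complex.I)) •
        circleIntegralM 1 (fun z =>
          z ^ (y₂ - y₁ - 1) • A16 a0 a1 b0 b1 z ^ (x₁ - x₂).toNat)
      + (1 / (2 * (Real.pi : ℂ) * Complex.I)) •
        circleIntegralM 1 (fun w => circleIntegralM 1 (fun z =>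
          (w ^ (y₂ - (m : ℤ) - (n : ℤ)) * z ^ (-y₁ - 1)) •
            (A16 a0 a1 b0 b1 w ^ ((L : ℤ) - x₂).toNat * K w z *
              A16 a0 a1 b0 b1 z ^ x₁.toNat)))
    = -((if x₂ < x₁ then (1 : ℂ) else 0) /
          (2 * (Real.pi : ℂ) * Complex.I * (2 * (a0 : ℂ) * (a1 : ℂ)))) •
        circleIntegralM ρ (fun ζ =>
          ((((b0 : ℂ) + (b1 : ℂ) + ζ) / 2) ^ (x₁ - x₂) *
            ((ζ ^ 2 - ((b0 : ℂ) - (b1 : ℂ)) ^ 2) / (4 * (a0 : ℂ) * (a1 : ℂ))) ^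
              (y₂ - y₁ - 1)) •
          !![(ζ - (b1 : ℂ) + (b0 : ℂ)) / 2, (a0 : ℂ);
             (ζ ^ 2 - ((b1 : ℂ) - (b0 : ℂ)) ^ 2) / (4 * (a0 : ℂ)),
             (ζ + (b1 : ℂ) - (b0 : ℂ)) / 2])
      + (1 / (2 * (Real.pi : ℂ) * Complex.I * (4 * (a0 : ℂ) ^ 2 * (a1 : ℂ) ^ 2))) •
        circleIntegralM ρ (fun ω => circleIntegralM ρ (fun ζ =>
          (Ks ω ζ * (((b0 : ℂ) + (b1 : ℂ) + ζ) / 2) ^ x₁ *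
            (((b0 : ℂ) + (b1 : ℂ) + ω) / 2) ^ ((L : ℤ) - x₂) *
            ((ζ ^ 2 - ((b1 : ℂ) - (b0 : ℂ)) ^ 2) / (4 * (a0 : ℂ) * (a1 : ℂ))) ^ (-y₁ - 1) *
            ((ω ^ 2 - ((b1 : ℂ) - (b0 : ℂ)) ^ 2) / (4 * (a0 : ℂ) * (a1 : ℂ))) ^
              (y₂ - (m : ℤ) - (n : ℤ))) •
          !![(ζ - ((b1 : ℂ) - (b0 : ℂ))) / 2, (a0 : ℂ);
             (ζ - (b1 : ℂ) + (b0 : ℂ)) * (ω + (b1 : ℂ) - (b0 : ℂ)) / (4 * (a0 : ℂ)),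
             (ω + (b1 : ℂ) - (b0 : ℂ)) / 2])) := by
  have h0 : (a0 : ℂ) ≠ 0 := by exact_mod_cast ha0.ne'
  have hKs' := hKsU _ (isLeftRKCircleS_curveKernel ha0 ha1 hρ hn hK)
  subst hKs'
  have hM : ∀ ζ ω : ℂ, !![(ζ - ((b1 : ℂ) - (b0 : ℂ))) / 2, (a0 : ℂ);
      (ζ - (b1 : ℂ) + (b0 : ℂ)) * (ω + (b1 : ℂ) - (b0 : ℂ)) / (4 * (a0 : ℂ)),
      (ω + (b1 : ℂ) - (b0 : ℂ)) / 2] =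
      Matrix.of fun a b => 1 / (a0 : ℂ) * (rightEig a0 b0 b1 ω a * leftEig a0 b0 b1 ζ b) := by
    intro ζ ω
    ext a b
    fin_cases a <;> fin_cases b <;> simp [rightEig, leftEig] <;> field_simp <;> ring
  have hM' : ∀ ζ : ℂ, !![(ζ - (b1 : ℂ) + (b0 : ℂ)) / 2, (a0 : ℂ);
      (ζ ^ 2 - ((b1 : ℂ) - (b0 : ℂ)) ^ 2) / (4 * (a0 : ℂ)), (ζ + (b1 : ℂ) - (b0 : ℂ)) / 2] =
      Matrix.of fun a b => 1 / (a0 : ℂ) * (rightEig a0 b0 b1 ζ a * leftEig a0 b0 b1 ζ b) := by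
    intro ζ
    ext a b
    fin_cases a <;> fin_cases b <;> simp [rightEig, leftEig] <;> field_simp <;> ring
  have hZ : ∀ ζ : ℂ, (ζ ^ 2 - ((b1 : ℂ) - (b0 : ℂ)) ^ 2) / (4 * (a0 : ℂ) * (a1 : ℂ)) =
      curveZ a0 a1 b0 b1 ζ := by
    intro ζ
    rw [curveZ, sub_sq_comm]
  have hpow : ∀ (ζ : ℂ) (k : ℤ), 0 ≤ k →
      (((b0 : ℂ) + (b1 : ℂ) + ζ) / 2) ^ k = curveEig b0 b1 ζ ^ k.toNat := by
    intro ζ k hk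
    rw [curveEig, ← zpow_natCast, Int.toNat_of_nonneg hk]
  simp only [hM, hM', hZ, hpow _ x₁ (by omega), hpow _ ((L : ℤ) - x₂) (by omega)]
  ext a b
  simp only [Matrix.add_apply, Matrix.smul_apply, circleIntegralM_apply, Matrix.of_apply,
    smul_eq_mul]
  congr 1
  · split_ifs with hx
    · have h := circleIntegral_A16_pow ha0 ha1 hρ (y₂ - y₁ - 1) 1 (x₁ - x₂).toNat a b
      simp only [Polynomial.eval_one, mul_one] at h
      rw [h, ← circleIntegral.integral_const_mul, ← circleIntegral.integral_const_mul]
      congr 1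
      funext ζ
      rw [hpow _ _ (by omega), ← curveZ]
      ring
    · simp
  · rw [circleIntegral_circleIntegral_kernel ha0 ha1 hρ hK.1 hK.2.1]
    simp only [circleIntegral.integral_const_mul]
    ring
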